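/- Let y ≥ 2, t ≥ 2 with y ≥ (log t)², and set s = log t / log y. Then Σ_{m ≥ t, P⁺(m) ≤ y} 1/φ(m) ≪ (log y) · e^{−s log(s+1)}, with an absolute implied constant. -/

import Mathlib

open Finset in
/-- Abel summation against Chebyshev's bound `θ(n) ≤ n log 4`. -/
theorem sum_primesLE_log_mul_rpow_neg_le (N : ℕ) {a : ℝ} (ha : 0 ≤ a) :
    ∑ p ∈ Nat.primesLE N, Real.log p * (p : ℝ) ^ (-a) ≤
      Real.log 4 * ∑ n ∈ Icc 1 N, (n : ℝ) ^ (-a) := by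
  suffices h : ∑ p ∈ Nat.primesLE N, Real.log p * (p : ℝ) ^ (-a) +
      (Real.log 4 * N - Chebyshev.theta N) * (N : ℝ) ^ (-a) ≤
      Real.log 4 * ∑ n ∈ Icc 1 N, (n : ℝ) ^ (-a) by
    have h1 := Chebyshev.theta_le_log4_mul_x (Nat.cast_nonneg (α := ℝ) N)
    have h2 : 0 ≤ (Real.log 4 * N - Chebyshev.theta N) * (N : ℝ) ^ (-a) :=
      mul_nonneg (by linarith) (by positivity)
    linarith
  induction N with
  | zero => simp
  | succ N ih =>
    have hsum (f : ℕ → ℝ) : ∑ p ∈ Nat.primesLE (N + 1), f p =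
        ∑ p ∈ Nat.primesLE N, f p + if (N + 1).Prime then f (N + 1) else 0 := by
      simp only [Nat.primesLE_eq_filter_range, sum_filter]
      rw [sum_range_succ]
    have hθ : Chebyshev.theta ((N + 1 : ℕ) : ℝ) = Chebyshev.theta N +
        if (N + 1).Prime then Real.log ((N + 1 : ℕ) : ℝ) else 0 := by
      rw [Chebyshev.theta_eq_sum_primesLE_log, Chebyshev.theta_eq_sum_primesLE_log,
        hsum fun p => Real.log p]
    have h1 := Chebyshev.theta_le_log4_mul_x (Nat.cast_nonneg (α := ℝ) N)
    have hmono : (Real.log 4 * N - Chebyshev.theta N) * ((N + 1 : ℕ) : ℝ) ^ (-a) ≤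
        (Real.log 4 * N - Chebyshev.theta N) * (N : ℝ) ^ (-a) := by
      rcases Nat.eq_zero_or_pos N with rfl | hN
      · simp
      · refine mul_le_mul_of_nonneg_left ?_ (by linarith)
        exact Real.rpow_le_rpow_of_nonpos (by positivity) (by simp) (by linarith)
    rw [sum_Icc_succ_top (by omega), hsum, hθ]
    split_ifs <;> push_cast at * <;> nlinarith

/-- Comparison of `∑ n^(η-1)` with the integral of `u^(η-1)`. -/
theorem sum_Icc_rpow_sub_one_le (N : ℕ) {η : ℝ} (h0 : 0 < η) (h1 : η ≤ 1) :
    ∑ n ∈ Finset.Icc 1 N, (n : ℝ) ^ (η - 1) ≤ (N : ℝ) ^ η / η := by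
  induction N with
  | zero => simp [h0.ne']
  | succ N ih =>
    rw [Finset.sum_Icc_succ_top (by omega)]
    have hpos : (0 : ℝ) < (N : ℝ) + 1 := by positivity
    have hb : (N : ℝ) ^ η ≤ ((N : ℝ) + 1) ^ η - η * ((N : ℝ) + 1) ^ (η - 1) := by
      have h := rpow_one_add_le_one_add_mul_self (s := -1 / ((N : ℝ) + 1))
        (by rw [le_div_iff₀ hpos]; simp) h0.le h1
      have he : (N : ℝ) = ((N : ℝ) + 1) * (1 + -1 / ((N : ℝ) + 1)) := by field_simp; ring
      have hn : 0 ≤ 1 + -1 / ((N : ℝ) + 1) := by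
        have : 1 + -1 / ((N : ℝ) + 1) = N / (N + 1) := by field_simp; ring
        rw [this]; positivity
      calc (N : ℝ) ^ η = ((N : ℝ) + 1) ^ η * (1 + -1 / ((N : ℝ) + 1)) ^ η := by
            conv_lhs => rw [he]
            rw [Real.mul_rpow hpos.le hn]
        _ ≤ ((N : ℝ) + 1) ^ η * (1 + η * (-1 / ((N : ℝ) + 1))) := by gcongr
        _ = _ := by rw [Real.rpow_sub_one hpos.ne']; ring
    calc _ ≤ (N : ℝ) ^ η / η + ((N : ℝ) + 1) ^ (η - 1) := by push_cast; gcongr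
      _ ≤ (((N : ℝ) + 1) ^ η - η * ((N : ℝ) + 1) ^ (η - 1)) / η + ((N : ℝ) + 1) ^ (η - 1) := by
        gcongr
      _ = _ := by push_cast; field_simp; ring

/-- Partial sums of `ζ(1 + δ)` are at most `1 + 1/δ`. -/
theorem sum_Icc_rpow_neg_le (N : ℕ) {δ : ℝ} (h0 : 0 < δ) :
    ∑ n ∈ Finset.Icc 1 N, (n : ℝ) ^ (-(1 + δ)) ≤ 1 + 1 / δ := by
  rcases Nat.eq_zero_or_pos N with rfl | hN
  · simp; positivity
  suffices h : ∑ n ∈ Finset.Icc 1 N, (n : ℝ) ^ (-(1 + δ)) ≤ 1 + 1 / δ - (N : ℝ) ^ (-δ) / δ by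
    have : 0 ≤ (N : ℝ) ^ (-δ) / δ := by positivity
    linarith
  induction N, hN using Nat.le_induction with
  | base => simp
  | succ N hN ih =>
    rw [Finset.sum_Icc_succ_top (by omega)]
    have hN0 : (0 : ℝ) < N := by exact_mod_cast hN
    have hpos : (0 : ℝ) < (N : ℝ) + 1 := by positivity
    have hb : ((N : ℝ) + 1) ^ (-δ) + δ * ((N : ℝ) + 1) ^ (-(1 + δ)) ≤ (N : ℝ) ^ (-δ) := by
      have hl : Real.log N ≤ Real.log (N + 1) - 1 / ((N : ℝ) + 1) := by
        have h := Real.log_le_sub_one_of_pos (x := (N : ℝ) / (N + 1)) (by positivity)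
        rw [Real.log_div hN0.ne' hpos.ne'] at h
        have : (N : ℝ) / (N + 1) - 1 = -(1 / ((N : ℝ) + 1)) := by field_simp; ring
        linarith
      calc _ = ((N : ℝ) + 1) ^ (-δ) * (δ / ((N : ℝ) + 1) + 1) := by
            rw [show -(1 + δ) = -δ - 1 by ring, Real.rpow_sub_one hpos.ne']; ring
        _ ≤ ((N : ℝ) + 1) ^ (-δ) * Real.exp (δ / ((N : ℝ) + 1)) := by
            gcongr; exact Real.add_one_le_exp _
        _ ≤ _ := by
            rw [Real.rpow_def_of_pos hpos, Real.rpow_def_of_pos hN0, ← Real.exp_add]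
            apply Real.exp_le_exp.2
            have := mul_le_mul_of_nonneg_left hl h0.le
            have e : δ / ((N : ℝ) + 1) = δ * (1 / ((N : ℝ) + 1)) := by ring
            rw [e]; nlinarith
    have hb' : ((N : ℝ) + 1) ^ (-(1 + δ)) ≤ ((N : ℝ) ^ (-δ) - ((N : ℝ) + 1) ^ (-δ)) / δ := by
      rw [le_div_iff₀ h0]; linarith
    have e : ((N : ℝ) ^ (-δ) - ((N : ℝ) + 1) ^ (-δ)) / δ =
      (N : ℝ) ^ (-δ) / δ - ((N : ℝ) + 1) ^ (-δ) / δ := by ring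
    push_cast
    linarith

/-- The partial harmonic sums, in the form used below. -/
theorem sum_Icc_inv_le (N : ℕ) :
    ∑ n ∈ Finset.Icc 1 N, (n : ℝ)⁻¹ ≤ 1 + Real.log N := by
  have h := harmonic_le_one_add_log N
  rw [harmonic_eq_sum_Icc] at h
  push_cast at h
  exact h

/-- The prime zeta function is at most `log (1 + 1/δ)` at `1 + δ`. -/
theorem sum_primesLE_rpow_neg_le (N : ℕ) {δ : ℝ} (h0 : 0 < δ) :
    ∑ p ∈ Nat.primesLE N, (p : ℝ) ^ (-(1 + δ)) ≤ Real.log (1 + 1 / δ) := by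
  have hs : Summable fun n : ℕ => (n : ℝ) ^ (-(1 + δ)) :=
    Real.summable_nat_rpow.2 (by linarith)
  have hprod := EulerProduct.prod_primesBelow_tsum_eq_tsum_smoothNumbers
    (f := fun n : ℕ => (n : ℝ) ^ (-(1 + δ))) (by simp)
    (fun {m n} _ => by push_cast; exact Real.mul_rpow (by positivity) (by positivity))
    hs.norm (N + 1)
  have hle : ∑' m : (N + 1).smoothNumbers, ((m : ℕ) : ℝ) ^ (-(1 + δ)) ≤ 1 + 1 / δ := by
    refine (hs.tsum_subtype_le (fun n : ℕ => (n : ℝ) ^ (-(1 + δ))) _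
      (fun n => by positivity)).trans ?_
    refine Real.tsum_le_of_sum_range_le (fun n => by positivity) fun n => ?_
    refine le_trans ?_ (sum_Icc_rpow_neg_le n h0)
    rw [← Finset.sum_subset (s₁ := (Finset.range n).filter (· ≠ 0)) (Finset.filter_subset _ _)]
    · refine Finset.sum_le_sum_of_subset_of_nonneg ?_ fun i _ _ => by positivity
      intro i hi
      simp at hi ⊢
      omega
    · intro i _ hi
      have : i = 0 := by simp_all
      subst this
      simpa using Real.zero_rpow (by linarith : -(1 + δ) ≠ 0)
  rw [Real.le_log_iff_exp_le (by positivity), Real.exp_sum]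
  refine le_trans ?_ (hprod.trans_le hle)
  refine Finset.prod_le_prod (fun p _ => by positivity) fun p hp => ?_
  have hp2 : (1 : ℝ) < p := by exact_mod_cast (Nat.prime_of_mem_primesLE hp).one_lt
  set x := (p : ℝ) ^ (-(1 + δ)) with hx
  have hx1 : x < 1 := Real.rpow_lt_one_of_one_lt_of_neg hp2 (by linarith)
  have hx0 : 0 ≤ x := by positivity
  have hterm (n : ℕ) : ((p ^ n : ℕ) : ℝ) ^ (-(1 + δ)) = x ^ n := by
    rw [hx]; push_cast
    rw [← Real.rpow_natCast, ← Real.rpow_natCast, ← Real.rpow_mul (by positivity),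
      ← Real.rpow_mul (by positivity), mul_comm]
  simp_rw [hterm]
  rw [tsum_geometric_of_lt_one hx0 hx1, ← one_div, le_div_iff₀ (by linarith)]
  calc Real.exp x * (1 - x) ≤ Real.exp x * Real.exp (-x) := by
        gcongr; exact Real.one_sub_le_exp_neg x
    _ = 1 := by rw [← Real.exp_add]; simp

/-- Upper bound in Mertens' second theorem. -/
theorem sum_primesLE_inv_le (N : ℕ) {δ : ℝ} (h0 : 0 < δ) :
    ∑ p ∈ Nat.primesLE N, (p : ℝ)⁻¹ ≤
      Real.log (1 + 1 / δ) + δ * (Real.log 4 * (1 + Real.log N)) := by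
  have h1 := sum_primesLE_rpow_neg_le N h0
  have h2 := sum_primesLE_log_mul_rpow_neg_le N (a := 1) zero_le_one
  simp_rw [Real.rpow_neg_one] at h2
  have h3 : Real.log 4 * ∑ n ∈ Finset.Icc 1 N, (n : ℝ)⁻¹ ≤ Real.log 4 * (1 + Real.log N) :=
    mul_le_mul_of_nonneg_left (sum_Icc_inv_le N) (Real.log_nonneg (by norm_num))
  calc ∑ p ∈ Nat.primesLE N, (p : ℝ)⁻¹ ≤
      ∑ p ∈ Nat.primesLE N, ((p : ℝ) ^ (-(1 + δ)) + δ * (Real.log p * (p : ℝ)⁻¹)) := by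
        refine Finset.sum_le_sum fun p hp => ?_
        have hp0 : (0 : ℝ) < p := by exact_mod_cast (Nat.prime_of_mem_primesLE hp).pos
        have := Real.add_one_le_exp (Real.log p * -δ)
        rw [← Real.rpow_def_of_pos hp0] at this
        rw [show -(1 + δ) = -δ - 1 by ring, Real.rpow_sub_one hp0.ne', div_eq_mul_inv]
        have := mul_le_mul_of_nonneg_right this (inv_pos.2 hp0).le
        nlinarith
    _ ≤ _ := by
        rw [Finset.sum_add_distrib, ← Finset.mul_sum]
        gcongr
        exact h2.trans h3

/-- For any fixed `D`, the excess of `∑ p^(η-1)` over `∑ 1/p` is at most `O(N^η / D) + O_D(1)`. -/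
theorem sum_primesLE_rpow_sub_one_le (N : ℕ) {η D : ℝ} (h0 : 0 < η) (h1 : η ≤ 1) (hD : 0 < D) :
    ∑ p ∈ Nat.primesLE N, (p : ℝ) ^ (η - 1) ≤
      ∑ p ∈ Nat.primesLE N, (p : ℝ)⁻¹ +
        Real.log 4 * ((N : ℝ) ^ η / D + 2 * Real.exp (2 * D)) := by
  have ha := sum_primesLE_log_mul_rpow_neg_le N (a := 1 - η) (by linarith)
  have hb := sum_primesLE_log_mul_rpow_neg_le N (a := 1 + η) (by linarith)
  have hc := sum_Icc_rpow_sub_one_le N h0 h1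
  have hd := sum_Icc_rpow_neg_le N h0
  rw [neg_sub] at ha
  have hl4 : 0 ≤ Real.log 4 := Real.log_nonneg (by norm_num)
  calc ∑ p ∈ Nat.primesLE N, (p : ℝ) ^ (η - 1) ≤
      ∑ p ∈ Nat.primesLE N, ((p : ℝ)⁻¹ + (η / D * (Real.log p * (p : ℝ) ^ (η - 1)) +
        η * Real.exp (2 * D) * (Real.log p * (p : ℝ) ^ (-(1 + η))))) := by
        refine Finset.sum_le_sum fun p hp => ?_
        have hp1 : (1 : ℝ) < p := by exact_mod_cast (Nat.prime_of_mem_primesLE hp).one_lt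
        have hp0 : (0 : ℝ) < p := by linarith
        have hv : 0 < Real.log p * η := mul_pos (Real.log_pos hp1) h0
        rw [show -(1 + η) = -η - 1 by ring, Real.rpow_sub_one hp0.ne', Real.rpow_sub_one hp0.ne',
          Real.rpow_def_of_pos hp0, Real.rpow_def_of_pos hp0, mul_neg]
        generalize hvv : Real.log p * η = v at hv
        have key : Real.exp v ≤ 1 + v * Real.exp v / D + v * Real.exp (2 * D) * Real.exp (-v) := by
          rcases le_total D v with h | h
          · have : Real.exp v ≤ v * Real.exp v / D := by
              rw [le_div_iff₀ hD, mul_comm]; gcongr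
            have : 0 ≤ v * Real.exp (2 * D) * Real.exp (-v) := by positivity
            linarith
          · have e1 : Real.exp v - 1 ≤ v * Real.exp v := by
              have := Real.one_sub_le_exp_neg v
              have e : Real.exp (-v) * Real.exp v = 1 := by rw [← Real.exp_add]; simp
              nlinarith [Real.exp_pos v]
            have e2 : Real.exp v ≤ Real.exp (2 * D) * Real.exp (-v) := by
              rw [← Real.exp_add]; apply Real.exp_le_exp.2; linarith
            have e3 : 0 ≤ v * Real.exp v / D := by positivity
            nlinarith
        have := mul_le_mul_of_nonneg_right key (inv_pos.2 hp0).le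
        rw [← hvv] at this ⊢
        calc _ = _ := div_eq_mul_inv _ _
          _ ≤ _ := this
          _ = _ := by ring
    _ = ∑ p ∈ Nat.primesLE N, (p : ℝ)⁻¹ +
        (η / D * ∑ p ∈ Nat.primesLE N, Real.log p * (p : ℝ) ^ (η - 1) +
        η * Real.exp (2 * D) * ∑ p ∈ Nat.primesLE N, Real.log p * (p : ℝ) ^ (-(1 + η))) := by
        simp only [Finset.sum_add_distrib, Finset.mul_sum]
    _ ≤ ∑ p ∈ Nat.primesLE N, (p : ℝ)⁻¹ +
        (η / D * (Real.log 4 * ((N : ℝ) ^ η / η)) +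
        η * Real.exp (2 * D) * (Real.log 4 * (1 + 1 / η))) := by
        gcongr
        · exact ha.trans (mul_le_mul_of_nonneg_left hc hl4)
        · exact hb.trans (mul_le_mul_of_nonneg_left hd hl4)
    _ ≤ _ := by
        have e1 : η / D * (Real.log 4 * ((N : ℝ) ^ η / η)) = Real.log 4 * ((N : ℝ) ^ η / D) := by
          field_simp
        have e2 : η * Real.exp (2 * D) * (Real.log 4 * (1 + 1 / η)) =
            Real.log 4 * ((η + 1) * Real.exp (2 * D)) := by
          field_simp
        rw [e1, e2, mul_add (Real.log 4)]
        gcongr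
        linarith

/-- The local Euler factor of `m^η / φ(m)`, with `x = p^(η-1)`. -/
theorem hasSum_prime_pow_rpow_div_totient {p : ℕ} (hp : p.Prime) {η : ℝ} (h : η < 1) :
    HasSum (fun n : ℕ => ((p ^ n : ℕ) : ℝ) ^ η / (Nat.totient (p ^ n) : ℝ))
      (1 + p / (p - 1) * ((p : ℝ) ^ (η - 1) / (1 - (p : ℝ) ^ (η - 1)))) := by
  have hp1 : (1 : ℝ) < p := by exact_mod_cast hp.one_lt
  have hp0 : (0 : ℝ) < p := by linarith
  set x := (p : ℝ) ^ (η - 1) with hx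
  have hx1 : x < 1 := Real.rpow_lt_one_of_one_lt_of_neg hp1 (by linarith)
  have hx0 : 0 ≤ x := by positivity
  have hpx : (p : ℝ) ^ η = p * x := by rw [hx, Real.rpow_sub_one hp0.ne']; field_simp
  have hterm (n : ℕ) : ((p ^ (n + 1) : ℕ) : ℝ) ^ η / (Nat.totient (p ^ (n + 1)) : ℝ) =
      p / (p - 1) * x * x ^ n := by
    have e : ((p ^ (n + 1) : ℕ) : ℝ) ^ η = (p * x) ^ (n + 1) := by
      rw [← hpx]; push_cast
      rw [← Real.rpow_natCast, ← Real.rpow_natCast, ← Real.rpow_mul hp0.le,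
        ← Real.rpow_mul hp0.le, mul_comm]
    rw [e, Nat.totient_prime_pow_succ hp]
    push_cast [Nat.cast_sub hp.one_le]
    have : (p : ℝ) - 1 ≠ 0 := by linarith
    field_simp
    ring
  rw [← hasSum_nat_add_iff' 1]
  simp_rw [hterm]
  have e : 1 + p / (p - 1) * (x / (1 - x)) -
      ∑ i ∈ Finset.range 1, ((p ^ i : ℕ) : ℝ) ^ η / (Nat.totient (p ^ i) : ℝ) =
      p / (p - 1) * x * (1 - x)⁻¹ := by
    simp
    ring
  rw [e]
  exact (hasSum_geometric_of_lt_one hx0 hx1).mul_left (p / (p - 1) * x)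

/-- The local Euler factor of `m^η / φ(m)` is `exp (x + O(x²))`. -/
theorem prime_factor_le_exp {p : ℕ} (hp : p.Prime) {η : ℝ} (h0 : 0 ≤ η) (h : η ≤ 1 / 2) :
    1 + p / (p - 1) * ((p : ℝ) ^ (η - 1) / (1 - (p : ℝ) ^ (η - 1))) ≤
      Real.exp ((p : ℝ) ^ (η - 1) + 14 * (p : ℝ) ^ (2 * η - 2)) := by
  have hp2 : (2 : ℝ) ≤ p := by exact_mod_cast hp.two_le
  have hp0 : (0 : ℝ) < p := by linarith
  have hsq : (p : ℝ) ^ (2 * η - 2) = ((p : ℝ) ^ (η - 1)) ^ 2 := by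
    rw [← Real.rpow_natCast, ← Real.rpow_mul hp0.le]
    congr 1
    push_cast
    ring
  have hhalf : (p : ℝ) ^ (2 * η - 2) ≤ 1 / 2 := by
    calc (p : ℝ) ^ (2 * η - 2) ≤ (p : ℝ) ^ (-1 : ℝ) :=
          Real.rpow_le_rpow_of_exponent_le (by linarith) (by linarith)
      _ ≤ 1 / 2 := by
          rw [Real.rpow_neg_one, ← one_div]
          exact one_div_le_one_div_of_le (by norm_num) hp2
  have hinv : (p : ℝ)⁻¹ ≤ (p : ℝ) ^ (η - 1) := by
    rw [← Real.rpow_neg_one]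
    exact Real.rpow_le_rpow_of_exponent_le (by linarith) (by linarith)
  rw [hsq] at hhalf ⊢
  have hx0 : 0 ≤ (p : ℝ) ^ (η - 1) := by positivity
  generalize (p : ℝ) ^ (η - 1) = x at *
  have hx : x ≤ 3 / 4 := by nlinarith
  have h1 : (p : ℝ) / (p - 1) ≤ 1 + 2 * x := by
    have : (p : ℝ) / (p - 1) ≤ 1 + 2 * (p : ℝ)⁻¹ := by
      rw [div_le_iff₀ (by linarith)]
      field_simp
      nlinarith
    linarith
  have h2 : x / (1 - x) ≤ x * (1 + 4 * x) := by
    rw [div_le_iff₀ (by linarith)]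
    have : 0 ≤ x * (x * (3 - 4 * x)) := mul_nonneg hx0 (mul_nonneg hx0 (by linarith))
    nlinarith
  have h3 : (p : ℝ) / (p - 1) * (x / (1 - x)) ≤ (1 + 2 * x) * (x * (1 + 4 * x)) :=
    mul_le_mul h1 h2 (div_nonneg hx0 (by linarith)) (by linarith)
  have h4 := Real.add_one_le_exp (x + 14 * x ^ 2)
  have h5 : 0 ≤ x ^ 2 * (1 - x) := mul_nonneg (sq_nonneg x) (by linarith)
  nlinarith

/-- Euler product bound for the sum of `m^η / φ(m)` over smooth numbers. -/
theorem summable_and_tsum_smoothNumbers_rpow_div_totient_le (N : ℕ) {η : ℝ} (h0 : 0 ≤ η)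
    (h : η ≤ 1 / 2) :
    (Summable fun m : (N + 1).smoothNumbers => ((m : ℕ) : ℝ) ^ η / (Nat.totient m : ℝ)) ∧
      ∑' m : (N + 1).smoothNumbers, ((m : ℕ) : ℝ) ^ η / (Nat.totient m : ℝ) ≤
        Real.exp (∑ p ∈ Nat.primesLE N, (p : ℝ) ^ (η - 1) +
          14 * ∑ p ∈ Nat.primesLE N, (p : ℝ) ^ (2 * η - 2)) := by
  have hmain := EulerProduct.summable_and_hasSum_smoothNumbers_prod_primesBelow_tsum
    (f := fun m : ℕ => (m : ℝ) ^ η / (Nat.totient m : ℝ)) (by simp)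
    (fun {m n} hmn => by
      rw [Nat.totient_mul hmn]
      push_cast
      rw [Real.mul_rpow (by positivity) (by positivity), mul_div_mul_comm])
    (fun {p} hp => (hasSum_prime_pow_rpow_div_totient hp (by linarith)).summable.norm) (N + 1)
  refine ⟨hmain.2.summable, ?_⟩
  rw [hmain.2.tsum_eq, Finset.mul_sum, ← Finset.sum_add_distrib, Real.exp_sum]
  refine Finset.prod_le_prod (fun p _ => tsum_nonneg fun n => by positivity) fun p hp => ?_
  have hp' := Nat.prime_of_mem_primesLE hp
  rw [(hasSum_prime_pow_rpow_div_totient hp' (by linarith)).tsum_eq]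
  exact prime_factor_le_exp hp' h0 h

open Classical in
/-- Rankin's trick for the sum of `1/φ(m)` over `y`-smooth `m ≥ t`. -/
theorem tsum_smooth_inv_totient_le {y t η : ℝ} (ht : 0 < t) (h0 : 0 ≤ η)
    (h : η ≤ 1 / 2) :
    (∑' m : ℕ, (if ((t ≤ (m : ℝ)) ∧ ∀ p : ℕ, p.Prime → p ∣ m → (p : ℝ) ≤ y)
          then 1 / (Nat.totient m : ℝ) else 0)) ≤
      t ^ (-η) * Real.exp (∑ p ∈ Nat.primesLE ⌊y⌋₊, (p : ℝ) ^ (η - 1) +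
          14 * ∑ p ∈ Nat.primesLE ⌊y⌋₊, (p : ℝ) ^ (2 * η - 2)) := by
  obtain ⟨hs, hle⟩ := summable_and_tsum_smoothNumbers_rpow_div_totient_le ⌊y⌋₊ h0 h
  set F : ℕ → ℝ := (⌊y⌋₊ + 1).smoothNumbers.indicator
    fun m : ℕ => (m : ℝ) ^ η / (Nat.totient m : ℝ) with hF
  have hsF : Summable F := summable_subtype_iff_indicator.1 hs
  rw [tsum_subtype _ fun m : ℕ => (m : ℝ) ^ η / (Nat.totient m : ℝ), ← hF] at hle
  have hF0 (m : ℕ) : 0 ≤ F m := Set.indicator_nonneg (fun m _ => by positivity) m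
  have hpt (m : ℕ) : (if ((t ≤ (m : ℝ)) ∧ ∀ p : ℕ, p.Prime → p ∣ m → (p : ℝ) ≤ y)
      then 1 / (Nat.totient m : ℝ) else 0) ≤ t ^ (-η) * F m := by
    split_ifs with hm
    · have hm0 : (0 : ℝ) < m := ht.trans_le hm.1
      have hmem : m ∈ (⌊y⌋₊ + 1).smoothNumbers := by
        rw [Nat.mem_smoothNumbers']
        exact fun p hp hd => Nat.lt_succ_of_le (Nat.le_floor (hm.2 p hp hd))
      rw [hF, Set.indicator_of_mem hmem, ← mul_div_assoc]
      gcongr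
      rw [Real.rpow_neg ht.le, inv_mul_eq_div, one_le_div (by positivity)]
      exact Real.rpow_le_rpow ht.le hm.1 h0
    · exact mul_nonneg (by positivity) (hF0 m)
  have hsum : Summable fun m => t ^ (-η) * F m := hsF.mul_left _
  have hsL := Summable.of_nonneg_of_le (fun m => by split_ifs <;> positivity) hpt hsum
  calc _ ≤ ∑' m, t ^ (-η) * F m := hsL.tsum_le_tsum hpt hsum
    _ = t ^ (-η) * ∑' m, F m := tsum_mul_left
    _ ≤ _ := by gcongr

/-- Mertens' upper bound with explicit constants. -/
theorem sum_primesLE_floor_inv_le {y : ℝ} (hy : 2 ≤ y) :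
    ∑ p ∈ Nat.primesLE ⌊y⌋₊, (p : ℝ)⁻¹ ≤ Real.log (3 * Real.log y) + 6 := by
  have hl2 := Real.log_two_gt_d9
  have hl2' := Real.log_two_lt_d9
  have hly : 0.69 ≤ Real.log y := by
    have := Real.log_le_log (by norm_num) hy
    norm_num at *; linarith
  have hly0 : 0 < Real.log y := by norm_num at hly; linarith
  have hl4 : Real.log 4 = 2 * Real.log 2 := by
    rw [show (4 : ℝ) = 2 ^ 2 by norm_num, Real.log_pow]; norm_num
  have hN : Real.log (⌊y⌋₊ : ℝ) ≤ Real.log y := by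
    refine Real.log_le_log ?_ (Nat.floor_le (by linarith))
    exact_mod_cast Nat.floor_pos.2 (by linarith)
  refine (sum_primesLE_inv_le ⌊y⌋₊ (δ := 1 / Real.log y) (by positivity)).trans ?_
  rw [one_div_one_div]
  refine add_le_add (Real.log_le_log (by positivity) (by norm_num at hly; linarith)) ?_
  rw [one_div, inv_mul_le_iff₀ hly0, hl4]
  norm_num at hly hl2 hl2'
  nlinarith

/-- The second order term in the Euler product. -/
theorem sum_primesLE_floor_rpow_two_mul_sub_two_le {y η : ℝ} (hy : 2 ≤ y) (h0 : 0 ≤ η)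
    (h : η ≤ 1 / 2) :
    ∑ p ∈ Nat.primesLE ⌊y⌋₊, (p : ℝ) ^ (2 * η - 2) ≤ 3 + 4 * (η * Real.log y) := by
  have hly0 : 0 < Real.log y := Real.log_pos (by linarith)
  have hsub {a : ℝ} (ha : 2 * η - 2 ≤ a) : ∑ p ∈ Nat.primesLE ⌊y⌋₊, (p : ℝ) ^ (2 * η - 2) ≤
      ∑ n ∈ Finset.Icc 1 ⌊y⌋₊, (n : ℝ) ^ a := by
    calc _ ≤ ∑ p ∈ Nat.primesLE ⌊y⌋₊, (p : ℝ) ^ a := by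
          refine Finset.sum_le_sum fun p hp => ?_
          have hp1 : (1 : ℝ) ≤ p := by exact_mod_cast (Nat.prime_of_mem_primesLE hp).one_le
          exact Real.rpow_le_rpow_of_exponent_le hp1 ha
      _ ≤ _ := by
          refine Finset.sum_le_sum_of_subset_of_nonneg (fun p hp => ?_) fun i _ _ => by positivity
          have := Nat.mem_primesLE.1 hp
          exact Finset.mem_Icc.2 ⟨this.2.one_le, this.1⟩
  rcases le_total η (1 / 4) with hq | hq
  · refine (hsub (a := -(1 + 1 / 2)) (by linarith)).trans ?_
    have := sum_Icc_rpow_neg_le ⌊y⌋₊ (δ := 1 / 2) (by norm_num)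
    have : 0 ≤ η * Real.log y := by positivity
    norm_num at *
    linarith
  · refine (hsub (a := -1) (by linarith)).trans ?_
    simp_rw [Real.rpow_neg_one]
    have hN : Real.log (⌊y⌋₊ : ℝ) ≤ Real.log y := by
      refine Real.log_le_log ?_ (Nat.floor_le (by linarith))
      exact_mod_cast Nat.floor_pos.2 (by linarith)
    have := sum_Icc_inv_le ⌊y⌋₊
    nlinarith

/-- In the range of large `s`, the Rankin exponent `η = log (e (s + 1)) / log y` is at most `1/2`. -/
theorem one_add_log_le_half_log {y s : ℝ} (hy : 2 ≤ y) (hs : 100 ≤ s)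
    (hsy : (s * Real.log y) ^ 2 ≤ y) : 1 + Real.log (s + 1) ≤ Real.log y / 2 := by
  have hl2 := Real.log_two_gt_d9
  norm_num at hl2
  have hly : 69 / 100 ≤ Real.log y := by
    have := Real.log_le_log (by norm_num) hy
    linarith
  have h1 : (69 : ℝ) ^ 2 ≤ (s * Real.log y) ^ 2 := by
    have : (69 : ℝ) ≤ s * Real.log y := by nlinarith
    gcongr
  have h6 : 6 ≤ Real.log y := by
    rw [Real.le_log_iff_exp_le (by linarith)]
    have he : Real.exp 6 = Real.exp 1 ^ 6 := by rw [← Real.exp_nat_mul]; norm_num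
    have : Real.exp 1 ^ 6 ≤ 2.72 ^ 6 := by
      have := Real.exp_one_lt_d9
      gcongr
      linarith
    norm_num at this
    linarith
  have hle : Real.log (s * Real.log y) * 2 ≤ Real.log y := by
    have := Real.log_le_log (by positivity) hsy
    rw [Real.log_pow] at this
    push_cast at this
    linarith
  have hlast : 1 + Real.log (s + 1) ≤ Real.log (s * Real.log y) := by
    have e : 1 + Real.log (s + 1) = Real.log (Real.exp 1 * (s + 1)) := by
      rw [Real.log_mul (Real.exp_pos 1).ne' (by linarith), Real.log_exp]
    rw [e]
    refine Real.log_le_log (by positivity) ?_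
    have := Real.exp_one_lt_d9
    calc Real.exp 1 * (s + 1) ≤ 2.72 * (s + 1) := by gcongr; linarith
      _ ≤ s * 6 := by linarith
      _ ≤ s * Real.log y := by gcongr
  linarith

open Classical in
/-- Bound for the sum of `1/φ(m)` over `y`-smooth integers `m ≥ t`:
if `y ≥ 2`, `t ≥ 2` and `y ≥ (log t)²`, then with `s = log t / log y`,
`Σ_{m ≥ t, P⁺(m) ≤ y} 1/φ(m) ≪ (log y) e^{-s log(s+1)}` with an absolute
implied constant. -/
theorem stmt_12 :
    ∃ C : ℝ, 0 < C ∧ ∀ y t : ℝ, 2 ≤ y → 2 ≤ t → (Real.log t) ^ 2 ≤ y →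
      (∑' m : ℕ, (if ((t ≤ (m : ℝ)) ∧ ∀ p : ℕ, p.Prime → p ∣ m → (p : ℝ) ≤ y)
          then 1 / (Nat.totient m : ℝ) else 0))
        ≤ C * Real.log y *
            Real.exp (-(Real.log t / Real.log y) *
              Real.log (Real.log t / Real.log y + 1)) := by
  refine ⟨3 * Real.exp (200 + 4 * Real.exp 32 + 100 * Real.log 101 + 56 * Real.log 200),
    by positivity, fun y t hy ht hty => ?_⟩
  have hly0 : 0 < Real.log y := Real.log_pos (by linarith)
  have hlt0 : 0 < Real.log t := Real.log_pos (by linarith)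
  have hl101 : 0 ≤ Real.log 101 := Real.log_nonneg (by norm_num)
  have hl200 : 0 ≤ Real.log 200 := Real.log_nonneg (by norm_num)
  have hE := Real.exp_pos 32
  set s := Real.log t / Real.log y with hs
  have hst : s * Real.log y = Real.log t := div_mul_cancel₀ _ hly0.ne'
  have hs0 : 0 < s := by positivity
  have hM := sum_primesLE_floor_inv_le hy
  suffices hη : ∃ η : ℝ, 0 ≤ η ∧ η ≤ 1 / 2 ∧
      -(η * Real.log t) + (∑ p ∈ Nat.primesLE ⌊y⌋₊, (p : ℝ) ^ (η - 1) +
        14 * ∑ p ∈ Nat.primesLE ⌊y⌋₊, (p : ℝ) ^ (2 * η - 2)) ≤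
      Real.log (3 * Real.log y) + (200 + 4 * Real.exp 32 + 100 * Real.log 101 +
        56 * Real.log 200) + -s * Real.log (s + 1) by
    obtain ⟨η, h0, h1, hb⟩ := hη
    refine (tsum_smooth_inv_totient_le (by linarith) h0 h1).trans ?_
    rw [Real.rpow_def_of_pos (by linarith), ← Real.exp_add]
    refine (Real.exp_le_exp.2 (le_trans (le_of_eq (by ring)) hb)).trans (le_of_eq ?_)
    rw [Real.exp_add, Real.exp_add (Real.log _), Real.exp_log (by positivity)]
    ring
  rcases le_total s 100 with hs100 | hs100
  · refine ⟨0, le_rfl, by norm_num, ?_⟩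
    have h2 := sum_primesLE_floor_rpow_two_mul_sub_two_le hy (η := 0) le_rfl (by norm_num)
    have h3 : s * Real.log (s + 1) ≤ 100 * Real.log 101 :=
      mul_le_mul hs100 (Real.log_le_log (by linarith) (by linarith))
        (Real.log_nonneg (by linarith)) (by norm_num)
    rw [zero_sub]
    simp_rw [Real.rpow_neg_one]
    rw [zero_mul] at h2
    generalize ∑ p ∈ Nat.primesLE ⌊y⌋₊, (p : ℝ) ^ (2 * (0 : ℝ) - 2) = S at *
    linarith
  · have hw := one_add_log_le_half_log hy hs100 (by rw [hst]; exact hty)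
    have hls : 0 ≤ Real.log (s + 1) := Real.log_nonneg (by linarith)
    have hηy : (1 + Real.log (s + 1)) / Real.log y * Real.log y = 1 + Real.log (s + 1) :=
      div_mul_cancel₀ _ hly0.ne'
    have hη0 : 0 < (1 + Real.log (s + 1)) / Real.log y := by positivity
    have hη1 : (1 + Real.log (s + 1)) / Real.log y ≤ 1 / 2 := by
      rw [div_le_iff₀ hly0]; linarith
    have hηt : (1 + Real.log (s + 1)) / Real.log y * Real.log t = s * (1 + Real.log (s + 1)) := by
      rw [← hst]; field_simp
    generalize (1 + Real.log (s + 1)) / Real.log y = η at *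
    refine ⟨η, hη0.le, hη1, ?_⟩
    have h1 := sum_primesLE_rpow_sub_one_le ⌊y⌋₊ hη0 (by linarith) (D := 16) (by norm_num)
    have h2 := sum_primesLE_floor_rpow_two_mul_sub_two_le hy hη0.le hη1
    have hN : ((⌊y⌋₊ : ℕ) : ℝ) ^ η ≤ 2.72 * (s + 1) := by
      calc ((⌊y⌋₊ : ℕ) : ℝ) ^ η ≤ y ^ η :=
            Real.rpow_le_rpow (by positivity) (Nat.floor_le (by linarith)) hη0.le
        _ = Real.exp 1 * (s + 1) := by
            rw [Real.rpow_def_of_pos (by linarith), mul_comm, hηy, Real.exp_add,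
              Real.exp_log (by linarith)]
        _ ≤ _ := by
            have := Real.exp_one_lt_d9
            gcongr
            linarith
    have hl4 : Real.log 4 ≤ 1.4 := by
      have := Real.log_two_lt_d9
      rw [show (4 : ℝ) = 2 ^ 2 by norm_num, Real.log_pow]
      push_cast
      linarith
    have h3 : Real.log 4 * (((⌊y⌋₊ : ℕ) : ℝ) ^ η / 16 + 2 * Real.exp (2 * 16)) ≤
        1.4 * (2.72 * (s + 1) / 16 + 2 * Real.exp 32) := by
      norm_num1
      gcongr
      · norm_num at hl4 ⊢; linarith
      · norm_num at hN ⊢; linarith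
    have h4 : Real.log (s + 1) ≤ (s + 1) / 200 + Real.log 200 := by
      have := Real.log_le_sub_one_of_pos (x := (s + 1) / 200) (by positivity)
      rw [Real.log_div (by positivity) (by norm_num)] at this
      linarith
    rw [hηt]
    rw [hηy] at h2
    norm_num at h3
    linarith
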